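/- Let (X,Φ) be a regular topological flow, let B be a weakly extendable cross-section of time η > 0, and let A ⊆ B. Then: (1) Int^Φ(A) is an open subset of B for the topology induced on B; (2) ∂_B A ⊆ ∂^Φ A ⊆ ∂_B A ∪ ∂^Φ B, where ∂_B A denotes the boundary of A with respect to the topology induced on B. -/

import Mathlib

open Set Filter Topology MeasureTheory

namespace FlowPaper

variable {X : Type*} [MetricSpace X]

/-- The flow `Φ` is regular when no point is fixed by the whole flow. -/
def Regular (Φ : Flow ℝ X) : Prop := ∀ x : X, ∃ t : ℝ, Φ t x ≠ x

/-- `φ_I(E) = {φ_t x : t ∈ I, x ∈ E}`. -/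
def flowSet (Φ : Flow ℝ X) (I : Set ℝ) (E : Set X) : Set X := ⋃ t ∈ I, Φ t '' E

/-- The `ζ`-cylinder `S_ζ = φ_{[-ζ,ζ]}(S)`. -/
def cyl (Φ : Flow ℝ X) (S : Set X) (ζ : ℝ) : Set X := flowSet Φ (Icc (-ζ) ζ) S

/-- `S` is a cross-section of time `η` if `Φ` is injective on `S × [-η,η]`. -/
def IsCrossSection (Φ : Flow ℝ X) (S : Set X) (η : ℝ) : Prop :=
  Set.InjOn (fun p : X × ℝ => Φ p.2 p.1) (S ×ˢ Icc (-η) η)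

/-- Weakly extendable cross-section of time `η`. -/
def IsWec (Φ : Flow ℝ X) (S : Set X) (η : ℝ) : Prop :=
  IsCrossSection Φ S η ∧ IsCrossSection Φ (closure S) η

/-- The flow interior `Int^Φ(S) = Int(S_η) ∩ S`. -/
def flowInterior (Φ : Flow ℝ X) (S : Set X) (η : ℝ) : Set X := interior (cyl Φ S η) ∩ S

/-- The flow boundary `∂^Φ S = closure S \ Int^Φ(S)`. -/
def flowBoundary (Φ : Flow ℝ X) (S : Set X) (η : ℝ) : Set X := closure S \ flowInterior Φ S η

/-- `∂^Φ S_ζ = φ_{[-ζ,ζ]}(∂^Φ S)`. -/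
def flowBoundaryCyl (Φ : Flow ℝ X) (S : Set X) (η ζ : ℝ) : Set X := cyl Φ (flowBoundary Φ S η) ζ

/-- A cross-section is global when some cylinder covers `X`. -/
def IsGlobal (Φ : Flow ℝ X) (S : Set X) : Prop := ∃ ξ > 0, cyl Φ S ξ = univ

/-- First return time `t_S(x) = inf {t > 0 : φ_t x ∈ S}`. -/
noncomputable def returnTime (Φ : Flow ℝ X) (S : Set X) (x : X) : ℝ :=
  sInf {t : ℝ | 0 < t ∧ Φ t x ∈ S}

/-- First return map `T_S(x) = φ_{t_S(x)}(x)`. -/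
noncomputable def returnMap (Φ : Flow ℝ X) (S : Set X) (x : X) : X := Φ (returnTime Φ S x) x

/-- A measure is `Φ`-invariant when it is invariant under every time `t`-map. -/
def FlowInvariant [MeasurableSpace X] (Φ : Flow ℝ X) (μ : Measure X) : Prop :=
  ∀ t : ℝ, Measure.map (Φ t) μ = μ

/-- A w.e.c. `S` of time `η` has small flow boundary when `∂^Φ S_η` is a null set. -/
def HasSmallFlowBoundary [MeasurableSpace X] (Φ : Flow ℝ X) (S : Set X) (η : ℝ) : Prop :=
  ∀ μ : Measure X, IsProbabilityMeasure μ → FlowInvariant Φ μ → μ (flowBoundaryCyl Φ S η η) = 0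

/-- The small flow boundary property of a flow. -/
def SmallFlowBoundaryProperty [MeasurableSpace X] (Φ : Flow ℝ X) : Prop :=
  ∀ x : X, ∀ S' : Set X, ∀ η : ℝ, 0 < η → IsWec Φ S' η → x ∈ flowInterior Φ S' η →
    ∃ S ⊆ S', x ∈ flowInterior Φ S η ∧ IsWec Φ S η ∧ HasSmallFlowBoundary Φ S η

/-- The frontier of `A` with respect to the topology induced on `B`. -/
def frontierIn (B A : Set X) : Set X :=
  Subtype.val '' (frontier (Subtype.val ⁻¹' A : Set B))

theorem mem_cyl {Φ : Flow ℝ X} {S : Set X} {ζ : ℝ} {x : X} :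
    x ∈ cyl Φ S ζ ↔ ∃ t ∈ Icc (-ζ) ζ, ∃ s ∈ S, Φ t s = x := by
  simp [cyl, flowSet]

/-- The cylinder of a subset of a cross-section meets the cross-section only in that subset. -/
theorem IsCrossSection.cyl_inter_subset {Φ : Flow ℝ X}
    {A B : Set X} {η : ℝ} (hη : 0 ≤ η) (hB : IsCrossSection Φ B η) (hAB : A ⊆ B) :
    cyl Φ A η ∩ B ⊆ A := by
  rintro x ⟨hx, hxB⟩
  obtain ⟨t, ht, a, ha, rfl⟩ := mem_cyl.1 hx
  have h0 : (0 : ℝ) ∈ Icc (-η) η := ⟨neg_nonpos.2 hη, hη⟩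
  have h := hB (Set.mk_mem_prod hxB h0) (Set.mk_mem_prod (hAB ha) ht) (by simp)
  have hta : Φ t a = a := (Prod.ext_iff.1 h).1
  exact hta.symm ▸ ha

theorem flowInterior_eq_interior_cyl_inter {Φ : Flow ℝ X}
    {A B : Set X} {η : ℝ} (hη : 0 ≤ η) (hB : IsCrossSection Φ B η) (hAB : A ⊆ B) :
    flowInterior Φ A η = interior (cyl Φ A η) ∩ B :=
  Subset.antisymm (inter_subset_inter_right _ hAB) fun _ hx =>
    ⟨hx.1, hB.cyl_inter_subset hη hAB ⟨interior_subset hx.1, hx.2⟩⟩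

theorem mem_frontierIn {A B : Set X} (hAB : A ⊆ B) {x : X} :
    x ∈ frontierIn B A ↔
      x ∈ B ∧ x ∈ closure A ∧ ∀ U : Set X, IsOpen U → x ∈ U → ¬ U ∩ B ⊆ A := by
  have hcl (y : B) : y ∈ closure (Subtype.val ⁻¹' A : Set B) ↔ (y : X) ∈ closure A := by
    rw [closure_subtype, Subtype.image_preimage_coe, inter_eq_right.2 hAB]
  have hint (y : B) : y ∈ interior (Subtype.val ⁻¹' A : Set B) ↔
      ∃ U : Set X, IsOpen U ∧ (y : X) ∈ U ∧ U ∩ B ⊆ A := by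
    rw [mem_interior]
    constructor
    · rintro ⟨V, hVA, hV, hy⟩
      obtain ⟨U, hU, rfl⟩ := isOpen_induced_iff.1 hV
      exact ⟨U, hU, hy, fun z hz => @hVA ⟨z, hz.2⟩ hz.1⟩
    · rintro ⟨U, hU, hy, hUA⟩
      exact ⟨_, fun z hz => hUA ⟨hz, z.2⟩, hU.preimage continuous_subtype_val, hy⟩
  constructor
  · rintro ⟨y, hy, rfl⟩
    exact ⟨y.2, (hcl y).1 hy.1, fun U hU hyU hUA => hy.2 ((hint y).2 ⟨U, hU, hyU, hUA⟩)⟩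
  · rintro ⟨hxB, hxA, hx⟩
    refine ⟨⟨x, hxB⟩, ⟨(hcl _).2 hxA, fun h => ?_⟩, rfl⟩
    obtain ⟨U, hU, hxU, hUA⟩ := (hint _).1 h
    exact hx U hU hxU hUA

/-- A point of the flow interior of `B` that is interior to `A` relative to `B` lies in the
interior of the cylinder of `A`. -/
theorem mem_interior_cyl_of_inter_subset [CompactSpace X]
    {Φ : Flow ℝ X} {A B U : Set X} {η : ℝ} (hη : 0 ≤ η)
    (hB : IsCrossSection Φ (closure B) η) (hU : IsOpen U) (hUA : U ∩ B ⊆ A) {x : X} (hxU : x ∈ U)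
    (hx : x ∈ flowInterior Φ B η) : x ∈ interior (cyl Φ A η) := by
  have hcont : Continuous fun p : X × ℝ => Φ p.2 p.1 := Φ.continuous continuous_snd continuous_fst
  set K : Set X := (fun p : X × ℝ => Φ p.2 p.1) '' ((closure B \ U) ×ˢ Icc (-η) η)
  have hKc : IsClosed K :=
    (((isClosed_closure.sdiff hU).isCompact.prod isCompact_Icc).image hcont).isClosed
  have hxK : x ∉ K := by
    rintro ⟨⟨b, t⟩, ⟨hb, ht⟩, hbt⟩
    have h0 : (0 : ℝ) ∈ Icc (-η) η := ⟨neg_nonpos.2 hη, hη⟩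
    have h := hB (Set.mk_mem_prod hb.1 ht) (Set.mk_mem_prod (subset_closure hx.2) h0)
      (by simpa using hbt)
    obtain rfl : b = x := (Prod.ext_iff.1 h).1
    exact hb.2 hxU
  refine mem_interior.2 ⟨interior (cyl Φ B η) ∩ Kᶜ, ?_,
    isOpen_interior.inter hKc.isOpen_compl, hx.1, hxK⟩
  rintro y ⟨hy, hyK⟩
  obtain ⟨t, ht, b, hb, rfl⟩ := mem_cyl.1 (interior_subset hy)
  refine mem_cyl.2 ⟨t, ht, b, hUA ⟨?_, hb⟩, rfl⟩
  by_contra hbU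
  exact hyK ⟨(b, t), ⟨⟨subset_closure hb, hbU⟩, ht⟩, rfl⟩

/-- for `A ⊆ B` with `B` a w.e.c. of time `η`, the flow interior of `A` is open
in `B`, and `∂_B A ⊆ ∂^Φ A ⊆ ∂_B A ∪ ∂^Φ B`. -/
theorem flowBoundary_subset_of_subset {X : Type*} [MetricSpace X] [CompactSpace X]
    (Φ : Flow ℝ X) (hreg : Regular Φ) (B : Set X) (η : ℝ) (hη : 0 < η)
    (hB : IsWec Φ B η) (A : Set X) (hAB : A ⊆ B) :
    (∃ U : Set X, IsOpen U ∧ flowInterior Φ A η = U ∩ B) ∧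
    frontierIn B A ⊆ flowBoundary Φ A η ∧
    flowBoundary Φ A η ⊆ frontierIn B A ∪ flowBoundary Φ B η := by
  have hint := flowInterior_eq_interior_cyl_inter hη.le hB.1 hAB
  refine ⟨⟨_, isOpen_interior, hint⟩, fun x hx => ?_, fun x hx => ?_⟩
  · obtain ⟨-, hxA, hx⟩ := (mem_frontierIn hAB).1 hx
    refine ⟨hxA, fun h => hx _ isOpen_interior h.1 ?_⟩
    rw [← hint]
    exact inter_subset_right
  · by_cases hxB : x ∈ flowInterior Φ B η
    · refine Or.inl ((mem_frontierIn hAB).2 ⟨hxB.2, hx.1, fun U hU hxU hUA => hx.2 ?_⟩)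
      exact ⟨mem_interior_cyl_of_inter_subset hη.le hB.2 hU hUA hxU hxB, hUA ⟨hxU, hxB.2⟩⟩
    · exact Or.inr ⟨closure_mono hAB hx.1, hxB⟩

end FlowPaper
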